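/- For every n ≥ 6, there exists no mechanism on the cycle C_n (vertex set {0,1,…,n−1} with edges between i and i+1 (mod n)) that is simultaneously anonymous, Pareto optimal, and group-manipulation-resistant. -/

import Mathlib

/- Common framework: finite connected simple graphs, shortest-path distance,
   profiles as lists of vertices, mechanisms as functions `List α → α`,
   anonymity, Pareto optimality, and group-manipulation-resistance. -/

open Classical

noncomputable section

/-- The ball of radius `r` around `v`. -/
def ball {α : Type} (G : SimpleGraph α) (v : α) (r : ℕ) : Set α :=
  {u | G.dist v u ≤ r}

/-- Distance from a vertex to a (nonempty) set of vertices. -/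
def distToSet {α : Type} (G : SimpleGraph α) (v : α) (Z : Finset α) : ℕ :=
  sInf ((fun z => G.dist v z) '' (Z : Set α))

/-- An agent located at `ℓ` weakly prefers `a` over `b`. -/
def wPref {α : Type} (G : SimpleGraph α) (ℓ a b : α) : Prop := G.dist ℓ a ≤ G.dist ℓ b

/-- An agent located at `ℓ` strictly prefers `a` over `b`. -/
def sPref {α : Type} (G : SimpleGraph α) (ℓ a b : α) : Prop := G.dist ℓ a < G.dist ℓ b

/-- `u` Pareto dominates `v` w.r.t. the profile `x`. -/
def Dominates {α : Type} (G : SimpleGraph α) (x : List α) (u v : α) : Prop :=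
  (∀ a ∈ x, wPref G a u v) ∧ (∃ a ∈ x, sPref G a u v)

/-- The set of Pareto optimal locations for a profile `x`. -/
def PO {α : Type} (G : SimpleGraph α) (x : List α) : Set α :=
  {v | ¬ ∃ u, Dominates G x u v}

/-- A mechanism is anonymous if its outcome is invariant under permutations of ballots. -/
def Anonymous {α : Type} (F : List α → α) : Prop :=
  ∀ x y : List α, x.Perm y → F x = F y

/-- A mechanism is Pareto optimal if its outcome is always Pareto optimal. -/
def ParetoOptimal {α : Type} (G : SimpleGraph α) (F : List α → α) : Prop :=
  ∀ x : List α, F x ∈ PO G x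

/-- The list of ballots `x j` for agents `j` outside the coalition `C`. -/
def profileMinus {α : Type} {n : ℕ} (x : Fin n → α) (C : Finset (Fin n)) : List α :=
  ((List.finRange n).filter (fun i => decide (i ∉ C))).map x

/-- Group-manipulation-resistance where all sincere ballots and all manipulated
ballots are required to lie in the set `S`. -/
def GMRon {α : Type} (G : SimpleGraph α) (S : Set α) (F : List α → α) : Prop :=
  ¬ ∃ (n : ℕ) (x : Fin n → α) (C : Finset (Fin n)) (A : List α),
      (∀ i, x i ∈ S) ∧ (∀ a ∈ A, a ∈ S) ∧
      (∀ i ∈ C, wPref G (x i) (F (A ++ profileMinus x C)) (F (List.ofFn x))) ∧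
      (∃ i ∈ C, sPref G (x i) (F (A ++ profileMinus x C)) (F (List.ofFn x)))

/-- Group-manipulation-resistance: no coalition `C` can, by replacing its ballots
with an arbitrary finite tuple `A` of ballots (misreporting, false-name voting,
or abstaining), obtain an outcome that all its members weakly prefer and at least
one member strictly prefers. -/
def GMR {α : Type} (G : SimpleGraph α) (F : List α → α) : Prop :=
  ¬ ∃ (n : ℕ) (x : Fin n → α) (C : Finset (Fin n)) (A : List α),
      (∀ i ∈ C, wPref G (x i) (F (A ++ profileMinus x C)) (F (List.ofFn x))) ∧
      (∃ i ∈ C, sPref G (x i) (F (A ++ profileMinus x C)) (F (List.ofFn x)))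

/-- The cycle graph on `ZMod n`: vertices `i` and `i + 1` (mod `n`) are adjacent. -/
def cycleG (n : ℕ) : SimpleGraph (ZMod n) :=
  SimpleGraph.fromRel (fun a b => b = a + 1)

theorem exists_walk_cycleG_add {n : ℕ} (hn : 2 ≤ n) (a : ZMod n) (k : ℕ) :
    ∃ p : (cycleG n).Walk a (a + k), p.length = k := by
  induction k with
  | zero => exact ⟨SimpleGraph.Walk.nil.copy rfl (by simp), by simp⟩
  | succ k ih =>
    obtain ⟨p, hp⟩ := ih
    have : Fact (1 < n) := ⟨hn⟩
    have h : (cycleG n).Adj (a + k) (a + (k + 1 : ℕ)) := by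
      simp [cycleG, SimpleGraph.fromRel_adj, add_assoc]
    exact ⟨p.concat h, by simp [hp]⟩

theorem natAbs_valMinAbs_le_length {n : ℕ} (hn : 2 ≤ n) {a b : ZMod n}
    (p : (cycleG n).Walk a b) : (b - a).valMinAbs.natAbs ≤ p.length := by
  have : Fact (1 < n) := ⟨hn⟩
  have : NeZero n := ⟨by omega⟩
  have h1 : (1 : ZMod n).valMinAbs.natAbs ≤ 1 := by
    rw [ZMod.valMinAbs_natAbs_eq_min, ZMod.val_one]
    exact min_le_left _ _
  induction p with
  | nil => simp
  | @cons u v w h p ih =>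
    have huv : (v - u).valMinAbs.natAbs ≤ 1 := by
      simp only [cycleG, SimpleGraph.fromRel_adj] at h
      rcases h.2 with h | h
      · simpa [h] using h1
      · rw [← neg_sub, ZMod.natAbs_valMinAbs_neg]
        simpa [h] using h1
    have := ZMod.natAbs_valMinAbs_add_le (w - v) (v - u)
    rw [sub_add_sub_cancel] at this
    have h2 := Int.natAbs_add_le (w - v).valMinAbs (v - u).valMinAbs
    rw [SimpleGraph.Walk.length_cons]
    omega

/-- The distance in the cycle from `c + i` to `c + j`. -/
theorem dist_cycleG {n : ℕ} (hn : 2 ≤ n) (c : ZMod n) {i j : ℕ} (hi : i < n) (hj : j < n) :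
    (cycleG n).dist (c + i) (c + j) =
      min ((i - j) + (j - i)) (n - ((i - j) + (j - i))) := by
  have : NeZero n := ⟨by omega⟩
  wlog hij : i ≤ j generalizing i j
  · rw [SimpleGraph.dist_comm, this hj hi (by omega), add_comm]
  obtain ⟨k, rfl⟩ := Nat.exists_eq_add_of_le hij
  obtain ⟨p, hp⟩ := exists_walk_cycleG_add hn (c + i) k
  obtain ⟨q, hq⟩ := exists_walk_cycleG_add hn (c + i + k) (n - k)
  have e1 : c + (i : ZMod n) + k = c + (i + k : ℕ) := by push_cast; ring
  have e2 : c + (i : ZMod n) + k + (n - k : ℕ) = c + i := by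
    rw [Nat.cast_sub (by omega)]; simp
  have h1 := SimpleGraph.dist_le p
  have h2 : (cycleG n).dist (c + i) (c + i + k) ≤ n - k := by
    have := SimpleGraph.dist_le q
    rwa [hq, e2, SimpleGraph.dist_comm] at this
  rw [hp] at h1
  obtain ⟨r, hr⟩ := p.reachable.exists_walk_length_eq_dist
  have h3 := natAbs_valMinAbs_le_length hn r
  rw [add_sub_cancel_left, ZMod.valMinAbs_natAbs_eq_min, ZMod.val_natCast,
    Nat.mod_eq_of_lt (by omega)] at h3
  rw [← e1]
  omega

theorem exists_eq_add_natCast {n : ℕ} (hn : 2 ≤ n) (c w : ZMod n) :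
    ∃ k < n, w = c + (k : ℕ) := by
  have : NeZero n := ⟨by omega⟩
  exact ⟨(w - c).val, ZMod.val_lt _, by simp⟩

/-- Under anonymity and manipulation-resistance, additional ballots never benefit
an agent already present. -/
theorem dist_le_dist_append {α : Type} {G : SimpleGraph α} {F : List α → α}
    (hA : Anonymous F) (hG : GMR G F) (x A : List α) {v : α} (hv : v ∈ x) :
    G.dist v (F x) ≤ G.dist v (F (x ++ A)) := by
  by_contra! h
  obtain ⟨i, rfl⟩ := List.get_of_mem hv
  have hp : ((x.get i :: A) ++ profileMinus x.get {i}).Perm (x ++ A) := by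
    have h1 : (i :: (List.finRange x.length).filter
        (fun j => decide (j ∉ ({i} : Finset (Fin x.length))))).Perm
        (List.finRange x.length) := by
      refine (List.perm_ext_iff_of_nodup ?_ (List.nodup_finRange _)).2 ?_
      · simp [List.Nodup.filter, List.nodup_finRange]
      · intro j
        by_cases hj : j = i <;> simp [hj]
    have h2 := h1.map x.get
    rw [List.map_get_finRange] at h2
    exact (List.perm_middle.symm.trans (List.perm_append_comm)).trans (h2.append_right A)
  refine hG ⟨x.length, x.get, {i}, x.get i :: A, ?_, i, by simp, ?_⟩
  · intro j hj
    obtain rfl := Finset.mem_singleton.1 hj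
    rw [wPref, hA _ _ hp, List.ofFn_get]
    exact h.le
  · rw [sPref, hA _ _ hp, List.ofFn_get]
    exact h

/-- Some location is weakly worse than the outcome, for all agents in every profile. -/
theorem exists_dist_outcome_le {α : Type} [Fintype α] {G : SimpleGraph α} (hc : G.Connected)
    {F : List α → α} (hA : Anonymous F) (hG : GMR G F) :
    ∃ c, ∀ x : List α, ∀ v ∈ x, G.dist v (F x) ≤ G.dist v c := by
  set L := (Finset.univ : Finset α).toList
  refine ⟨F L, fun x v hv => ?_⟩
  have h := dist_le_dist_append hA hG L x (v := F (L ++ x)) (by simp [L])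
  rw [SimpleGraph.dist_self, Nat.le_zero, hc.dist_eq_zero_iff] at h
  rw [← h, hA _ _ List.perm_append_comm]
  exact dist_le_dist_append hA hG x L hv

/-- The vertices of the cycle, other than `0`, that are weakly closer than `0` to both ends of
the arc from `b` to `b + m`. -/
theorem eq_of_cycle_dist_le {n m b k : ℕ} (hm : n = 2 * m ∨ n = 2 * m + 1) (hb : 1 ≤ b)
    (hbn : 2 * b < n) (hk : k < n) (hk0 : 0 < k)
    (h1 : min ((b - k) + (k - b)) (n - ((b - k) + (k - b))) ≤
      min ((b - 0) + (0 - b)) (n - ((b - 0) + (0 - b))))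
    (h2 : min ((b + m - k) + (k - (b + m))) (n - ((b + m - k) + (k - (b + m)))) ≤
      min ((b + m - 0) + (0 - (b + m))) (n - ((b + m - 0) + (0 - (b + m))))) :
    2 * b = k ∨ 2 * b = k + 1 ∧ n = 2 * m + 1 := by
  have e2 : n - (b + m) ≤ b + m := by omega
  rw [Nat.sub_zero, Nat.zero_sub, add_zero, min_eq_left (by omega : b ≤ n - b), min_le_iff] at h1
  rw [Nat.sub_zero, Nat.zero_sub, add_zero, min_eq_right e2, min_le_iff] at h2
  rcases le_total k b with h | h
  · rw [Nat.sub_eq_zero_of_le (h.trans (Nat.le_add_right b m))] at h2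
    rw [Nat.sub_eq_zero_of_le h] at h1
    rcases hm with rfl | rfl <;> omega
  rw [Nat.sub_eq_zero_of_le h] at h1
  rcases le_total k (b + m) with h' | h'
  · rw [Nat.sub_eq_zero_of_le h'] at h2
    rcases hm with rfl | rfl <;> omega
  · rw [Nat.sub_eq_zero_of_le h'] at h2
    rcases hm with rfl | rfl <;> omega

/-- Suppose that no agent is ever strictly worse off than at `c`. Then some location near the
middle of the arc from `c + b` to `c + (b + m)` is weakly worse than the outcome, for all agents in
every subprofile of a given profile on that arc. -/
theorem exists_dist_outcome_sublist_le {n m b : ℕ} {F : List (ZMod n) → ZMod n} {c : ZMod n}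
    (hA : Anonymous F) (hP : ParetoOptimal (cycleG n) F) (hG : GMR (cycleG n) F)
    (hc : ∀ x : List (ZMod n), ∀ v ∈ x, (cycleG n).dist v (F x) ≤ (cycleG n).dist v c)
    (hn : 2 ≤ n) (hm : n = 2 * m ∨ n = 2 * m + 1) (hb : 1 ≤ b) (hbn : 2 * b < n)
    {S : List ℕ} (hS : ∀ i ∈ S, b ≤ i ∧ i ≤ b + m) (hS' : ∃ i ∈ S, b < i ∧ i < b + m) :
    ∃ k < n, (2 * b = k ∨ 2 * b = k + 1 ∧ n = 2 * m + 1) ∧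
      ∀ T : List ℕ, T.Sublist S → ∀ i ∈ T, (cycleG n).dist (c + i)
        (F (T.map fun j : ℕ => c + (j : ZMod n))) ≤ (cycleG n).dist (c + i) (c + k) := by
  set f : ℕ → ZMod n := fun j => c + (j : ZMod n) with hf
  have hd : ∀ {i j : ℕ}, i < n → j < n → (cycleG n).dist (f i) (f j) =
      min ((i - j) + (j - i)) (n - ((i - j) + (j - i))) := fun hi hj => dist_cycleG hn c hi hj
  have hf0 : f 0 = c := by simp [hf]
  obtain ⟨k, hk, hFk⟩ := exists_eq_add_natCast hn c (F ((b :: (b + m) :: S).map f))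
  change _ = f k at hFk
  refine ⟨k, hk, ?_, fun T hT i hi => ?_⟩
  · have h1 := hc ((b :: (b + m) :: S).map f) (f b) (by simp)
    have h2 := hc ((b :: (b + m) :: S).map f) (f (b + m)) (by simp)
    rw [hFk, ← hf0, hd (by omega) (by omega), hd (by omega) (by omega)] at h1 h2
    have hk0 : k ≠ 0 := by
      rintro rfl
      obtain ⟨q, hqS, hq⟩ := hS'
      refine hP ((b :: (b + m) :: S).map f) ⟨f (2 * b), ?_, f q, ?_, ?_⟩
      · intro v hv
        obtain ⟨j, hj, rfl⟩ := List.mem_map.1 hv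
        have hj' : b ≤ j ∧ j ≤ b + m := by
          rcases List.mem_cons.1 hj with rfl | hj
          · omega
          rcases List.mem_cons.1 hj with rfl | hj
          · omega
          exact hS j hj
        rw [wPref, hFk, hd (by omega) (by omega), hd (by omega) (by omega)]
        omega
      · simp only [List.map_cons, List.mem_cons]
        exact Or.inr (Or.inr (List.mem_map_of_mem hqS))
      · rw [sPref, hFk, hd (by omega) (by omega), hd (by omega) (by omega)]
        omega
    exact eq_of_cycle_dist_le hm hb hbn hk (by omega) h1 h2
  · obtain ⟨A, hTA⟩ := (((hT.cons (b + m)).cons b).map f).exists_perm_append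
    change (cycleG n).dist (f i) _ ≤ (cycleG n).dist (f i) (f k)
    rw [← hFk, hA _ _ hTA]
    exact dist_le_dist_append hA hG _ _ (List.mem_map_of_mem hi)

/-- For every `n ≥ 6`, no mechanism on the cycle `Cₙ` is
simultaneously anonymous, Pareto optimal, and group-manipulation-resistant. -/
theorem no_good_mechanism_on_large_cycles :
    ∀ n : ℕ, 6 ≤ n → ∀ F : List (ZMod n) → ZMod n,
      ¬ (Anonymous F ∧ ParetoOptimal (cycleG n) F ∧ GMR (cycleG n) F) := by
  rintro n hn F ⟨hA, hP, hG⟩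
  have hn2 : 2 ≤ n := by omega
  have : NeZero n := ⟨by omega⟩
  have hconn : (cycleG n).Connected := by
    refine ⟨fun a b => ?_⟩
    obtain ⟨k, -, rfl⟩ := exists_eq_add_natCast hn2 a b
    exact (exists_walk_cycleG_add hn2 a k).choose.reachable
  obtain ⟨c, hc⟩ := exists_dist_outcome_le hconn hA hG
  obtain ⟨m, hm⟩ : ∃ m, n = 2 * m ∨ n = 2 * m + 1 := ⟨n / 2, by omega⟩
  obtain ⟨k₁, hk₁, h₁, H₁⟩ := exists_dist_outcome_sublist_le (b := 1) (S := [2, 4])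
    hA hP hG hc hn2 hm (by omega) (by omega) (by simp; omega) ⟨2, by simp; omega⟩
  obtain ⟨w, hw, hFw⟩ := exists_eq_add_natCast hn2 c (F ([2, 4].map fun j : ℕ => c + (j : ZMod n)))
  have a₂ := H₁ [2, 4] (by simp) 2 (by simp)
  have a₄ := H₁ [2, 4] (by simp) 4 (by simp)
  rw [hFw, dist_cycleG hn2 c (by omega) (by omega), dist_cycleG hn2 c (by omega) (by omega)]
    at a₂ a₄
  rcases id hm with hm' | hm'
  · obtain ⟨k₂, hk₂, h₂, H₂⟩ := exists_dist_outcome_sublist_le (b := 2) (S := [2, 4])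
      hA hP hG hc hn2 hm (by omega) (by omega) (by simp; omega) ⟨4, by simp; omega⟩
    have b₄ := H₂ [2, 4] (by simp) 4 (by simp)
    rw [hFw, dist_cycleG hn2 c (by omega) (by omega), dist_cycleG hn2 c (by omega) (by omega)]
      at b₄
    obtain rfl : 2 = k₁ := by clear * - h₁ hm'; omega
    obtain rfl : 4 = k₂ := by clear * - h₂ hm'; omega
    have hw2 : w = 2 := by clear * - a₂ hw hn; omega
    have hw4 : w = 4 := by clear * - b₄ hw hn; omega
    omega
  · obtain ⟨k₂, hk₂, h₂, H₂⟩ := exists_dist_outcome_sublist_le (b := 2) (S := [2, 3, 4, 5])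
      hA hP hG hc hn2 hm (by omega) (by omega) (by simp; omega) ⟨4, by simp; omega⟩
    obtain ⟨k₃, hk₃, h₃, H₃⟩ := exists_dist_outcome_sublist_le (b := 3) (S := [3, 5])
      hA hP hG hc hn2 hm (by omega) (by omega) (by simp; omega) ⟨5, by simp; omega⟩
    obtain ⟨z, hz, hFz⟩ :=
      exists_eq_add_natCast hn2 c (F ([3, 5].map fun j : ℕ => c + (j : ZMod n)))
    have b₄ := H₂ [2, 4] (by decide) 4 (by simp)
    have b₃ := H₂ [3, 5] (by decide) 3 (by simp)
    have c₅ := H₃ [3, 5] (by simp) 5 (by simp)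
    rw [hFw, dist_cycleG hn2 c (by omega) (by omega), dist_cycleG hn2 c (by omega) (by omega)]
      at b₄
    rw [hFz, dist_cycleG hn2 c (by omega) (by omega), dist_cycleG hn2 c (by omega) (by omega)]
      at b₃ c₅
    obtain rfl | rfl : k₂ = 3 ∨ k₂ = 4 := by clear * - h₂; omega
    · have hz3 : z = 3 := by clear * - b₃ hz hn; omega
      subst hz3
      clear * - c₅ h₃ hn
      omega
    · have hw4 : w = 4 := by clear * - b₄ hw hn; omega
      subst hw4
      clear * - a₂ h₁ hn
      omega
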